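/- Least radio-resource usage of the recursive starting times: if some t ∈ ℝ^N satisfies the arrival, deadline, and batch-causality constraints, then ∑_{n=1}^N ∑_{k∈𝒦_n} ℓ_k/(r_k·(t*_n − T^a_k)) ≤ ∑_{n=1}^N ∑_{k∈𝒦_n} ℓ_k/(r_k·(t_n − T^a_k)); that is, among all starting-time vectors satisfying these constraints, t* requires the least total bandwidth. -/

import Mathlib

/-- `Ξ = max_k T^d_k + (a·K + b)`. -/
noncomputable def Xi (K : ℕ) (hK : 0 < K) (a b : ℝ) (Td : Fin K → ℝ) : ℝ :=
  Finset.univ.sup' (Finset.univ_nonempty_iff.mpr ⟨⟨0, hK⟩⟩) Td + (a * K + b)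

/-- Inference delay of a batch of `m` tasks: `d(m) = a·m + b` for `m ≥ 1`, `d(0) = 0`. -/
noncomputable def dDelay (a b : ℝ) (m : ℕ) : ℝ := if m = 0 then 0 else a * m + b

/-- Auxiliary backward recursion: `tstarAux j` is the optimal starting time `t*_{N+1-j}`
of batch `N + 1 - j` (so `tstarAux 0 = t*_{N+1} = Ξ`). -/
noncomputable def tstarAux (K : ℕ) (hK : 0 < K) (a b : ℝ) (Td : Fin K → ℝ)
    (N : ℕ) (𝒦 : ℕ → Finset (Fin K)) : ℕ → ℝ
  | 0 => Xi K hK a b Td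
  | (j + 1) =>
      if h : (𝒦 (N - j)).Nonempty then
        min ((𝒦 (N - j)).inf' h Td) (tstarAux K hK a b Td N 𝒦 j)
          - dDelay a b (𝒦 (N - j)).card
      else tstarAux K hK a b Td N 𝒦 j

/-- The recursively defined batch starting times of Theorem 2:
`t*_{N+1} = Ξ` and, for `n = N, …, 1`,
`t*_n = min(χ_n, t*_{n+1}) − d_n` if `𝒦_n ≠ ∅`, and `t*_n = t*_{n+1}` otherwise. -/
noncomputable def tstar (K : ℕ) (hK : 0 < K) (a b : ℝ) (Td : Fin K → ℝ)
    (N : ℕ) (𝒦 : ℕ → Finset (Fin K)) (n : ℕ) : ℝ :=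
  tstarAux K hK a b Td N 𝒦 (N + 1 - n)

/-- Arrival constraints: `T^a_k < t_n` for all `1 ≤ n ≤ N` and all `k ∈ 𝒦_n`. -/
def ArrivalOK (K : ℕ) (Ta : Fin K → ℝ) (N : ℕ)
    (𝒦 : ℕ → Finset (Fin K)) (t : ℕ → ℝ) : Prop :=
  ∀ n ∈ Finset.Icc 1 N, ∀ k ∈ 𝒦 n, Ta k < t n

/-- Deadline constraints: `t_n + d_n ≤ T^d_k` for all `1 ≤ n ≤ N` and all `k ∈ 𝒦_n`. -/
def DeadlineOK (K : ℕ) (a b : ℝ) (Td : Fin K → ℝ) (N : ℕ)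
    (𝒦 : ℕ → Finset (Fin K)) (t : ℕ → ℝ) : Prop :=
  ∀ n ∈ Finset.Icc 1 N, ∀ k ∈ 𝒦 n, t n + dDelay a b (𝒦 n).card ≤ Td k

/-- Batch-causality constraints: `t_n + d_n ≤ t_{n+1}` for `1 ≤ n ≤ N − 1`. -/
def CausalOK (K : ℕ) (a b : ℝ) (N : ℕ)
    (𝒦 : ℕ → Finset (Fin K)) (t : ℕ → ℝ) : Prop :=
  ∀ n, 1 ≤ n → n + 1 ≤ N → t n + dDelay a b (𝒦 n).card ≤ t (n + 1)

/-- Bandwidth constraint: `∑_{n=1}^N ∑_{k∈𝒦_n} ℓ_k/(r_k·(t_n − T^a_k)) ≤ B`. -/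
def BandwidthOK (K : ℕ) (Ta ℓ r : Fin K → ℝ) (B : ℝ) (N : ℕ)
    (𝒦 : ℕ → Finset (Fin K)) (t : ℕ → ℝ) : Prop :=
  ∑ n ∈ Finset.Icc 1 N, ∑ k ∈ 𝒦 n, ℓ k / (r k * (t n - Ta k)) ≤ B

theorem le_Xi {K : ℕ} (hK : 0 < K) {a b : ℝ} (ha : 0 ≤ a) (hb : 0 ≤ b) (Td : Fin K → ℝ)
    (k : Fin K) : Td k ≤ Xi K hK a b Td := by
  have hmax : Td k ≤ Finset.univ.sup' (Finset.univ_nonempty_iff.mpr ⟨⟨0, hK⟩⟩) Td :=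
    Finset.le_sup' Td (Finset.mem_univ k)
  have hpos : 0 ≤ a * K + b := by positivity
  unfold Xi
  linarith

theorem dDelay_nonneg {a b : ℝ} (ha : 0 ≤ a) (hb : 0 ≤ b) (m : ℕ) : 0 ≤ dDelay a b m := by
  unfold dDelay
  split_ifs <;> positivity

/-- A time that is at most `Ξ` and at most the feasible starting time of batch `N + 1 - j` is at
most the recursive starting time of that batch. The bound by `Ξ` is needed because the starting
times of empty batches are not bounded by any deadline. -/
theorem le_tstarAux {K : ℕ} (hK : 0 < K) {a b : ℝ} (ha : 0 ≤ a) (hb : 0 ≤ b)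
    {Td : Fin K → ℝ} {N : ℕ} {𝒦 : ℕ → Finset (Fin K)} {t : ℕ → ℝ}
    (hdead : DeadlineOK K a b Td N 𝒦 t) (hcaus : CausalOK K a b N 𝒦 t)
    {j : ℕ} (hj : j ≤ N) {s : ℝ} (hsΞ : s ≤ Xi K hK a b Td)
    (hst : 1 ≤ j → s ≤ t (N + 1 - j)) : s ≤ tstarAux K hK a b Td N 𝒦 j := by
  induction j generalizing s with
  | zero => exact hsΞ
  | succ j ih =>
    have hs : s ≤ t (N - j) := by simpa using hst (by omega)
    have hmem : N - j ∈ Finset.Icc 1 N := by simp only [Finset.mem_Icc]; omega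
    have hnext : 1 ≤ j → s + dDelay a b (𝒦 (N - j)).card ≤ t (N + 1 - j) := by
      intro hj1
      have hc := hcaus (N - j) (by omega) (by omega)
      rw [show N - j + 1 = N + 1 - j by omega] at hc
      linarith
    rw [tstarAux]
    split_ifs with h
    · have hTd : ∀ k ∈ 𝒦 (N - j), s + dDelay a b (𝒦 (N - j)).card ≤ Td k := fun k hk => by
        linarith [hdead _ hmem k hk]
      obtain ⟨k, hk⟩ := h
      exact le_sub_iff_add_le.mpr (le_min (Finset.le_inf' _ _ hTd)
        (ih (by omega) ((hTd k hk).trans (le_Xi hK ha hb Td k)) hnext))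
    · exact ih (by omega) hsΞ fun hj1 => by
        linarith [hnext hj1, dDelay_nonneg ha hb (𝒦 (N - j)).card]

/-- Every feasible starting time of a nonempty batch is at most the recursive one. -/
theorem le_tstar {K : ℕ} (hK : 0 < K) {a b : ℝ} (ha : 0 ≤ a) (hb : 0 ≤ b)
    {Td : Fin K → ℝ} {N : ℕ} {𝒦 : ℕ → Finset (Fin K)} {t : ℕ → ℝ}
    (hdead : DeadlineOK K a b Td N 𝒦 t) (hcaus : CausalOK K a b N 𝒦 t)
    {n : ℕ} (hn : n ∈ Finset.Icc 1 N) (hne : (𝒦 n).Nonempty) :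
    t n ≤ tstar K hK a b Td N 𝒦 n := by
  obtain ⟨k, hk⟩ := hne
  have hn' := Finset.mem_Icc.mp hn
  refine le_tstarAux hK ha hb hdead hcaus (by omega) ?_ fun _ => ?_
  · linarith [hdead n hn k hk, le_Xi hK ha hb Td k, dDelay_nonneg ha hb (𝒦 n).card]
  · rw [show N + 1 - (N + 1 - n) = n by omega]

/-- Least radio-resource usage of the recursive starting times: if some
starting-time vector `t` satisfies the arrival, deadline, and batch-causality constraints,
then the total bandwidth required at `t*` is at most the total bandwidth required at `t`. -/
theorem tstar_least_bandwidth (K : ℕ) (hK : 0 < K) (a b B : ℝ)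
    (ha : 0 < a) (hb : 0 < b) (hB : 0 < B)
    (Ta Td ℓ r : Fin K → ℝ)
    (hTa : ∀ k, 0 ≤ Ta k) (hTaTd : ∀ k, Ta k < Td k)
    (hℓ : ∀ k, 0 < ℓ k) (hr : ∀ k, 0 < r k)
    (N : ℕ) (hN : 1 ≤ N) (𝒦 : ℕ → Finset (Fin K))
    (hdisj : ∀ m ∈ Finset.Icc 1 N, ∀ n ∈ Finset.Icc 1 N, m ≠ n → Disjoint (𝒦 m) (𝒦 n))
    (t : ℕ → ℝ)
    (harr : ArrivalOK K Ta N 𝒦 t)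
    (hdead : DeadlineOK K a b Td N 𝒦 t)
    (hcaus : CausalOK K a b N 𝒦 t) :
    ∑ n ∈ Finset.Icc 1 N, ∑ k ∈ 𝒦 n, ℓ k / (r k * (tstar K hK a b Td N 𝒦 n - Ta k))
      ≤ ∑ n ∈ Finset.Icc 1 N, ∑ k ∈ 𝒦 n, ℓ k / (r k * (t n - Ta k)) := by
  refine Finset.sum_le_sum fun n hn => Finset.sum_le_sum fun k hk => ?_
  have hle := le_tstar hK ha.le hb.le hdead hcaus hn ⟨k, hk⟩
  have hpos : 0 < t n - Ta k := sub_pos.mpr (harr n hn k hk)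
  have hrk := hr k
  have hℓk := hℓ k
  gcongr
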